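/- arXiv:math/0506064 — 3 statements merged into one kernel-verified Lean document; each statement's English description precedes it below -/
import Mathlib

section
/- For each triple i,j,k ∈ I there exists a unique scalar λ_{ijk} ∈ k such that ξ_{ij}(ξ_{jk}(a_{kji}·u)) = λ_{ijk}·ξ_{ik}(u) for all u ∈ M_k; moreover each λ_{ijk} is a unit of k, and these scalars satisfy the cocycle condition λ_{ijk}·λ_{ikl} = λ_{jkl}·λ_{ijl} for all i,j,k,l ∈ I. (This is Lemma 'le:cocycle1' of the paper, with c_{ijk} = λ_{kji}^{-1}.) -/
/-- Lemma `le:cocycle1` of the paper.  Given a `𝕜`-algebroid descent datum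
`(A i, f i j, a i j k)` (restricted to a fixed multiple intersection) and a family of
twisted-module isomorphisms `ξ i j : {}_{f j i} M j → M i`, each of which is a `𝕜`-basis
of the corresponding Hom-module, for every triple `i j k` there is a unique scalar
`λ i j k ∈ 𝕜` with `ξ i j (ξ j k (a k j i • u)) = λ i j k • ξ i k u`; each `λ i j k` is a
unit of `𝕜`, and they satisfy the cocycle condition
`λ i j k * λ i k l = λ j k l * λ i j l`. -/
theorem exists_unique_cocycle_scalar
    (𝕜 : Type*) [CommRing 𝕜] {I : Type*}
    (A : I → Type*) [∀ i, Ring (A i)] [∀ i, Algebra 𝕜 (A i)]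
    (f : ∀ i j, A j ≃ₐ[𝕜] A i)
    (a : ∀ i j k, (A i)ˣ)
    (hfa : ∀ i j k (x : A k),
      f i j (f j k x) = (a i j k : A i) * f i k x * (↑(a i j k)⁻¹ : A i))
    (ha : ∀ i j k l,
      (a i j k : A i) * (a i k l : A i) = f i j (a j k l : A j) * (a i j l : A i))
    (M : I → Type*) [∀ i, AddCommGroup (M i)] [∀ i, Module (A i) (M i)]
    (ξ : ∀ i j, M j → M i)
    (hadd : ∀ i j (m m' : M j), ξ i j (m + m') = ξ i j m + ξ i j m')
    (hlin : ∀ i j (b : A i) (m : M j), ξ i j (f j i b • m) = b • ξ i j m)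
    (hbij : ∀ i j, Function.Bijective (ξ i j))
    (hbasis : ∀ i j (η : M j → M i),
      (∀ m m', η (m + m') = η m + η m') →
      (∀ (b : A i) m, η (f j i b • m) = b • η m) →
      ∃! c : 𝕜, ∀ m, η m = algebraMap 𝕜 (A i) c • ξ i j m) :
    (∀ i j k, ∃! lam : 𝕜, ∀ u : M k,
        ξ i j (ξ j k ((a k j i : A k) • u)) = algebraMap 𝕜 (A i) lam • ξ i k u) ∧
    ∀ lam : I → I → I → 𝕜,
      (∀ i j k (u : M k),
        ξ i j (ξ j k ((a k j i : A k) • u)) = algebraMap 𝕜 (A i) (lam i j k) • ξ i k u) →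
      (∀ i j k, IsUnit (lam i j k)) ∧
      ∀ i j k l, lam i j k * lam i k l = lam j k l * lam i j l := by
  have hscal : ∀ i j (c : 𝕜) (m : M j),
      ξ i j (algebraMap 𝕜 (A j) c • m) = algebraMap 𝕜 (A i) c • ξ i j m := by
    intro i j c m
    rw [← hlin, AlgEquiv.commutes]
  have huniq : ∀ i j (c d : 𝕜),
      (∀ m, algebraMap 𝕜 (A i) c • ξ i j m = algebraMap 𝕜 (A i) d • ξ i j m) → c = d := by
    intro i j c d h
    refine (hbasis i j (fun m => algebraMap 𝕜 (A i) c • ξ i j m) ?_ ?_).unique (fun _ => rfl) h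
    · intro m m'
      rw [hadd, smul_add]
    · intro b m
      rw [hlin, smul_smul, smul_smul, Algebra.commutes]
  have hcompadd : ∀ i j k (u v : M k),
      ξ i j (ξ j k ((a k j i : A k) • (u + v))) =
        ξ i j (ξ j k ((a k j i : A k) • u)) + ξ i j (ξ j k ((a k j i : A k) • v)) := by
    intro i j k u v
    rw [smul_add, hadd, hadd]
  have hcomplin : ∀ i j k (b : A i) (u : M k),
      ξ i j (ξ j k ((a k j i : A k) • f k i b • u)) =
        b • ξ i j (ξ j k ((a k j i : A k) • u)) := by
    intro i j k b u
    rw [← hlin, ← hlin, hfa, smul_smul, smul_smul, mul_assoc _ _ (a k j i : A k),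
      Units.inv_mul, mul_one]
  refine ⟨fun i j k => hbasis i k _ (hcompadd i j k) (hcomplin i j k), fun lam hlam => ⟨?_, ?_⟩⟩
  · intro i j k
    have hη : Function.Bijective fun u : M k => ξ i j (ξ j k ((a k j i : A k) • u)) :=
      (hbij i j).comp ((hbij j k).comp (MulAction.bijective (a k j i)))
    obtain ⟨g, -, hg⟩ := Function.bijective_iff_has_inverse.mp hη
    have hgadd : ∀ m m', g (m + m') = g m + g m' := by
      intro m m'
      apply hη.1
      beta_reduce
      rw [hcompadd]
      exact (hg _).trans (congrArg₂ (· + ·) (hg m) (hg m')).symm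
    have hglin : ∀ (b : A i) m, g (b • m) = f k i b • g m := by
      intro b m
      apply hη.1
      beta_reduce
      rw [hcomplin]
      exact (hg _).trans (congrArg (b • ·) (hg m)).symm
    obtain ⟨μ, hμ, -⟩ := hbasis i k (fun m => ξ i k (g (ξ i k m)))
      (fun m m' => by rw [hadd, hgadd, hadd])
      (fun b m => by rw [hlin, hglin, hlin])
    refine IsUnit.of_mul_eq_one μ (huniq i k _ _ fun m => ?_)
    rw [map_mul, mul_smul, ← hμ, ← hlam, map_one, one_smul]
    exact hg (ξ i k m)
  · intro i j k l
    refine huniq i l _ _ fun u => ?_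
    rw [map_mul, map_mul, mul_smul, mul_smul, ← hlam i k l, ← hlam i j l, ← hlam i j k,
      ← hlin k l, smul_smul, ← ha l k j i, mul_smul, hlam j k l, hscal]
end

section
/- Define c_{ijk} := λ_{kji}^{-1} ∈ k^× and ã_{ijk} := c_{ijk}·a_{ijk} ∈ A_i^×. Then (A_i, f_{ij}, ã_{ijk}) is again a k-algebroid descent datum, i.e. f_{ij} ∘ f_{jk} = Ad(ã_{ijk}) ∘ f_{ik} and ã_{ijk}·ã_{ikl} = f_{ij}(ã_{jkl})·ã_{ijl} for all i,j,k,l ∈ I; and the family (M_i, ξ_{ij}) satisfies its glueing condition: ξ_{ij}(ξ_{jk}(u)) = ξ_{ik}(ã_{kji}^{-1}·u) for all u ∈ M_k and all i,j,k ∈ I. (This is Proposition 'pr:twistedglue' of the paper: (M_i, ξ_{ij}) is a twisted module over the datum twisted by the central cocycle c.) -/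
/-- Proposition `pr:twistedglue` of the paper.  With `c i j k := (λ k j i)⁻¹` and
`ã i j k := c i j k • a i j k`, the triple `(A i, f i j, ã i j k)` is again a
`𝕜`-algebroid descent datum, and the family `(M i, ξ i j)` satisfies the glueing
condition `ξ i j (ξ j k u) = ξ i k ((ã k j i)⁻¹ • u)`. -/
theorem twisted_glue
    (𝕜 : Type*) [CommRing 𝕜] {I : Type*}
    (A : I → Type*) [∀ i, Ring (A i)] [∀ i, Algebra 𝕜 (A i)]
    (f : ∀ i j, A j ≃ₐ[𝕜] A i)
    (a : ∀ i j k, (A i)ˣ)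
    (hfa : ∀ i j k (x : A k),
      f i j (f j k x) = (a i j k : A i) * f i k x * (↑(a i j k)⁻¹ : A i))
    (ha : ∀ i j k l,
      (a i j k : A i) * (a i k l : A i) = f i j (a j k l : A j) * (a i j l : A i))
    (M : I → Type*) [∀ i, AddCommGroup (M i)] [∀ i, Module (A i) (M i)]
    (ξ : ∀ i j, M j → M i)
    (hadd : ∀ i j (m m' : M j), ξ i j (m + m') = ξ i j m + ξ i j m')
    (hlin : ∀ i j (b : A i) (m : M j), ξ i j (f j i b • m) = b • ξ i j m)
    (hbij : ∀ i j, Function.Bijective (ξ i j))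
    (hbasis : ∀ i j (η : M j → M i),
      (∀ m m', η (m + m') = η m + η m') →
      (∀ (b : A i) m, η (f j i b • m) = b • η m) →
      ∃! c : 𝕜, ∀ m, η m = algebraMap 𝕜 (A i) c • ξ i j m)
    (lam : I → I → I → 𝕜ˣ)
    (hlam : ∀ i j k (u : M k),
      ξ i j (ξ j k ((a k j i : A k) • u)) = algebraMap 𝕜 (A i) (lam i j k : 𝕜) • ξ i k u)
    (hcoc : ∀ i j k l, lam i j k * lam i k l = lam j k l * lam i j l)
    -- `ã i j k := c i j k • a i j k`, where `c i j k := (λ k j i)⁻¹ ∈ 𝕜ˣ`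
    (atil : ∀ i j k, (A i)ˣ)
    (hatil : ∀ i j k,
      (atil i j k : A i) = algebraMap 𝕜 (A i) (((lam k j i)⁻¹ : 𝕜ˣ) : 𝕜) * (a i j k : A i)) :
    (∀ i j k (x : A k),
      f i j (f j k x) = (atil i j k : A i) * f i k x * (↑(atil i j k)⁻¹ : A i)) ∧
    (∀ i j k l,
      (atil i j k : A i) * (atil i k l : A i)
        = f i j (atil j k l : A j) * (atil i j l : A i)) ∧
    (∀ i j k (u : M k), ξ i j (ξ j k u) = ξ i k ((↑(atil k j i)⁻¹ : A k) • u)) := by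
  have scalar_lin : ∀ i j (c : 𝕜) (m : M j),
      ξ i j (algebraMap 𝕜 (A j) c • m) = algebraMap 𝕜 (A i) c • ξ i j m := by
    intro i j c m
    rw [← hlin, AlgEquiv.commutes]
  refine ⟨fun i j k x => ?_, fun i j k l => ?_, fun i j k u => ?_⟩
  · rw [Units.eq_mul_inv_iff_mul_eq, hatil, hfa, ← mul_assoc, ← Algebra.commutes,
      mul_assoc, mul_assoc, mul_assoc, Units.inv_mul, mul_one, mul_assoc]
  · have hc : (((lam k j i)⁻¹ : 𝕜ˣ) : 𝕜) * (((lam l k i)⁻¹ : 𝕜ˣ) : 𝕜)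
        = (((lam l k j)⁻¹ : 𝕜ˣ) : 𝕜) * (((lam l j i)⁻¹ : 𝕜ˣ) : 𝕜) := by
      rw [← Units.val_mul, ← Units.val_mul, ← mul_inv, ← mul_inv, hcoc l k j i]
    simp only [hatil, ← Algebra.smul_def, map_smul, smul_mul_smul_comm, hc, ha]
  · obtain ⟨v, rfl⟩ : ∃ v, u = (atil k j i : A k) • v :=
      ⟨(↑(atil k j i)⁻¹ : A k) • u, by rw [smul_smul, Units.mul_inv, one_smul]⟩
    rw [smul_smul, Units.inv_mul, one_smul, hatil, mul_smul, scalar_lin, scalar_lin, hlam,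
      smul_smul, ← map_mul, Units.inv_mul, map_one, one_smul]
end

section
/- Suppose given for each i ∈ I a subgroup B_i of the group of units A_i^× such that f_{ij}(B_j) ⊆ B_i for all i,j, such that for all b, b′ ∈ B_i the equality Ad(b) = Ad(b′) (as algebra automorphisms of A_i) implies b = b′, and such that a_{ijk} ∈ B_i for all i,j,k. Then the identity a_{ijk}·a_{ikl} = f_{ij}(a_{jkl})·a_{ijl} holds in A_i^× for all i,j,k,l ∈ I; that is, the cocycle condition (3.5) of the paper follows from the twisted composition condition (3.4). -/
/-- Remark `re:aafaa` of the paper.  If the units `a i j k` lie in subgroups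
`B i ⊆ (A i)ˣ` which are stable under the `f i j` and on which `Ad` is injective,
then the cocycle condition (3.5) follows from the twisted composition condition (3.4). -/
theorem cocycle_of_ad_injective
    (𝕜 : Type*) [CommRing 𝕜] {I : Type*}
    (A : I → Type*) [∀ i, Ring (A i)] [∀ i, Algebra 𝕜 (A i)]
    (f : ∀ i j, A j ≃ₐ[𝕜] A i)
    (a : ∀ i j k, (A i)ˣ)
    (hfa : ∀ i j k (x : A k),
      f i j (f j k x) = (a i j k : A i) * f i k x * (↑(a i j k)⁻¹ : A i))
    (B : ∀ i, Subgroup (A i)ˣ)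
    (hBf : ∀ i j (b : (A j)ˣ), b ∈ B j →
      Units.map ((f i j : A j ≃* A i) : A j →* A i) b ∈ B i)
    (hBinj : ∀ i (b b' : (A i)ˣ), b ∈ B i → b' ∈ B i →
      (∀ x : A i, (b : A i) * x * (↑b⁻¹ : A i) = (b' : A i) * x * (↑b'⁻¹ : A i)) → b = b')
    (hBa : ∀ i j k, a i j k ∈ B i) :
    ∀ i j k l,
      (a i j k : A i) * (a i k l : A i) = f i j (a j k l : A j) * (a i j l : A i) := by
  intro i j k l
  have key : a i j k * a i k l =
      Units.map ((f i j : A j ≃* A i) : A j →* A i) (a j k l) * a i j l := by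
    refine hBinj i _ _ (mul_mem (hBa i j k) (hBa i k l))
      (mul_mem (hBf i j _ (hBa j k l)) (hBa i j l)) fun x => ?_
    obtain ⟨y, rfl⟩ := (f i l).surjective x
    have h := hfa i j k (f k l y)
    rw [hfa i k l, hfa j k l, map_mul, map_mul, hfa i j l] at h
    simp only [mul_inv_rev, Units.val_mul, ← map_inv, mul_assoc] at h ⊢
    exact h.symm
  exact congrArg Units.val key
end
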